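/- Let r ≥ 2 be an integer and let δ > 0 be a constant. If p = p(n) satisfies np → ∞ and p ≤ 1 − δ, then E[x_r(G_{n,p})] = Ω(√(n/p)); that is, there exist c > 0 and n_0 such that for all n ≥ n_0 the expected number of vertices of G_{n,p} not belonging to its (0,r)-core is at least c·√(n/p). -/

import Mathlib

open scoped Classical
open Filter

noncomputable section

/-- The possible edges of a graph on vertex set `Fin n`. -/
abbrev EdgeType (n : ℕ) := {e : Sym2 (Fin n) // ¬ e.IsDiag}

/-- A graph on vertex set `Fin n`, identified with its edge set. -/
abbrev EdgeGraph (n : ℕ) := Finset (EdgeType n)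

/-- The size of the `r`-cut given by `φ` in `G`. -/
def cutSize {n r : ℕ} (φ : Fin n → Fin r) (G : EdgeGraph n) : ℕ :=
  (G.filter fun e => ¬ (Sym2.map φ (e : Sym2 (Fin n))).IsDiag).card

/-- The maximum size of an `r`-cut of `G`. -/
def maxCut (n r : ℕ) (G : EdgeGraph n) : ℕ :=
  Finset.univ.sup fun φ : Fin n → Fin r => cutSize φ G

/-- The deficit of the `r`-cut `φ` in `G`. -/
def deficit {n : ℕ} (r : ℕ) (φ : Fin n → Fin r) (G : EdgeGraph n) : ℕ :=
  maxCut n r G - cutSize φ G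

/-- `u` and `v` are `(d,r)`-equivalent in `G`. -/
def EqvV {n : ℕ} (d r : ℕ) (G : EdgeGraph n) (u v : Fin n) : Prop :=
  ∀ φ : Fin n → Fin r, deficit r φ G ≤ d → φ u = φ v

/-- The `(d,r)`-component of `v` in `G`. -/
def component {n : ℕ} (d r : ℕ) (G : EdgeGraph n) (v : Fin n) : Finset (Fin n) :=
  Finset.univ.filter fun u => EqvV d r G v u

/-- The family of `(d,r)`-components of `G` having more than `n/(r+1)` vertices. -/
def coreSets {n : ℕ} (d r : ℕ) (G : EdgeGraph n) : Finset (Finset (Fin n)) :=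
  (Finset.univ.image fun v : Fin n => component d r G v).filter
    fun S => ((n : ℝ) / (r + 1)) < (S.card : ℝ)

/-- `G` has a `(d,r)`-core. -/
def HasCore {n : ℕ} (d r : ℕ) (G : EdgeGraph n) : Prop := (coreSets d r G).card = r

/-- The number `x_r(G)` of vertices of `G` outside of its `(0,r)`-core (all of `n` if `G` has
no `(0,r)`-core). -/
def xr {n : ℕ} (r : ℕ) (G : EdgeGraph n) : ℕ :=
  if HasCore 0 r G then
    (Finset.univ.filter fun v : Fin n =>
      ¬ ((n : ℝ) / (r + 1)) < ((component 0 r G v).card : ℝ)).card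
  else n

/-- Expectation of `f` under the binomial random graph `G_{n,p}`. -/
def exGnp (n : ℕ) (p : ℝ) (f : EdgeGraph n → ℝ) : ℝ :=
  ∑ G : EdgeGraph n, p ^ G.card * (1 - p) ^ (n.choose 2 - G.card) * f G

lemma card_edgeType (n : ℕ) : Fintype.card (EdgeType n) = n.choose 2 := by
  simpa using Sym2.card_subtype_not_diag (α := Fin n)

lemma exGnp_add (n : ℕ) (p : ℝ) (f g : EdgeGraph n → ℝ) :
    exGnp n p (fun G => f G + g G) = exGnp n p f + exGnp n p g := by
  simp only [exGnp, mul_add, Finset.sum_add_distrib]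

lemma exGnp_const_mul (n : ℕ) (p c : ℝ) (f : EdgeGraph n → ℝ) :
    exGnp n p (fun G => c * f G) = c * exGnp n p f := by
  simp only [exGnp, Finset.mul_sum]
  exact Finset.sum_congr rfl fun G _ => by ring

lemma exGnp_sum {ι : Type*} (n : ℕ) (p : ℝ) (s : Finset ι) (f : ι → EdgeGraph n → ℝ) :
    exGnp n p (fun G => ∑ i ∈ s, f i G) = ∑ i ∈ s, exGnp n p (f i) := by
  simp only [exGnp, Finset.mul_sum]
  exact Finset.sum_comm

lemma exGnp_mono {n : ℕ} {p : ℝ} (h0 : 0 ≤ p) (h1 : p ≤ 1) {f g : EdgeGraph n → ℝ}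
    (h : ∀ G, f G ≤ g G) : exGnp n p f ≤ exGnp n p g :=
  Finset.sum_le_sum fun G _ => mul_le_mul_of_nonneg_left (h G)
    (mul_nonneg (pow_nonneg h0 _) (pow_nonneg (sub_nonneg.2 h1) _))

lemma exGnp_const (n : ℕ) (p c : ℝ) : exGnp n p (fun _ => c) = c := by
  have h := Finset.sum_pow_mul_eq_add_pow p (1 - p) (Finset.univ : Finset (EdgeType n))
  rw [Finset.powerset_univ, Finset.card_univ, card_edgeType] at h
  rw [exGnp, ← Finset.sum_mul, h]
  simp

/-- A function of the status of `e` is independent of a function not depending on it. -/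
lemma exGnp_ite_mul {n : ℕ} (p : ℝ) (e : EdgeType n) (a b : ℝ) (g : EdgeGraph n → ℝ)
    (hg : ∀ G, g (insert e G) = g (G.erase e)) :
    exGnp n p (fun G => (if e ∈ G then a else b) * g G) =
      (p * a + (1 - p) * b) * exGnp n p g := by
  have key : ∀ f : EdgeGraph n → ℝ, exGnp n p f =
      ∑ G ∈ (Finset.univ.erase e).powerset,
        p ^ G.card * (1 - p) ^ (n.choose 2 - (G.card + 1)) *
          ((1 - p) * f G + p * f (insert e G)) := by
    intro f
    rw [exGnp, ← Finset.powerset_univ]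
    conv_lhs => rw [← Finset.insert_erase (Finset.mem_univ e)]
    rw [Finset.sum_powerset_insert (Finset.notMem_erase e _), ← Finset.sum_add_distrib]
    refine Finset.sum_congr rfl fun G hG => ?_
    have hsub := Finset.mem_powerset.1 hG
    have he : e ∉ G := fun h => Finset.notMem_erase e _ (hsub h)
    have hc : G.card + 1 ≤ n.choose 2 := by
      rw [← card_edgeType, ← Finset.card_insert_of_notMem he]
      exact Finset.card_le_univ _
    rw [Finset.card_insert_of_notMem he]
    obtain ⟨k, hk⟩ := Nat.exists_eq_add_of_le hc
    have h1 : n.choose 2 - G.card = k + 1 := by omega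
    have h2 : n.choose 2 - (G.card + 1) = k := by omega
    rw [h1, h2]
    ring
  rw [key, key, Finset.mul_sum]
  refine Finset.sum_congr rfl fun G hG => ?_
  have he : e ∉ G := fun h => Finset.notMem_erase e _ (Finset.mem_powerset.1 hG h)
  have h := hg G
  rw [Finset.erase_eq_of_notMem he] at h
  simp only [he, if_false, Finset.mem_insert_self, if_true, h]
  ring

/-- The centred indicator of the edge `e`. -/
def edgeDev {n : ℕ} (p : ℝ) (e : EdgeType n) (G : EdgeGraph n) : ℝ :=
  if e ∈ G then 1 - p else -p

/-- The deviation of the number of edges in `S` from its mean. -/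
def dev {n : ℕ} (p : ℝ) (S : Finset (EdgeType n)) (G : EdgeGraph n) : ℝ :=
  ∑ e ∈ S, edgeDev p e G

lemma exGnp_edgeDev_pow_mul {n : ℕ} (p : ℝ) (e : EdgeType n) (k : ℕ) (g : EdgeGraph n → ℝ)
    (hg : ∀ G, g (insert e G) = g (G.erase e)) :
    exGnp n p (fun G => edgeDev p e G ^ k * g G) =
      (p * (1 - p) ^ k + (1 - p) * (-p) ^ k) * exGnp n p g := by
  rw [← exGnp_ite_mul p e _ _ g hg]
  simp only [edgeDev, ite_pow]

lemma exGnp_edgeDev_mul {n : ℕ} (p : ℝ) (e : EdgeType n) (g : EdgeGraph n → ℝ)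
    (hg : ∀ G, g (insert e G) = g (G.erase e)) :
    exGnp n p (fun G => edgeDev p e G * g G) = 0 := by
  have := exGnp_edgeDev_pow_mul p e 1 g hg
  simp only [pow_one] at this
  rw [this]
  ring

lemma edgeDev_congr {n : ℕ} (p : ℝ) {e e' : EdgeType n} (h : e' ≠ e) (G : EdgeGraph n) :
    edgeDev p e' (insert e G) = edgeDev p e' (G.erase e) := by
  simp [edgeDev, h]

lemma dev_congr {n : ℕ} (p : ℝ) {e : EdgeType n} {S : Finset (EdgeType n)} (h : e ∉ S)
    (G : EdgeGraph n) : dev p S (insert e G) = dev p S (G.erase e) :=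
  Finset.sum_congr rfl fun _ he' => edgeDev_congr p (ne_of_mem_of_not_mem he' h) G

lemma dev_eq {n : ℕ} (p : ℝ) (S : Finset (EdgeType n)) (G : EdgeGraph n) :
    dev p S G = ((S.filter (· ∈ G)).card : ℝ) - S.card * p := by
  have h : ∀ e, edgeDev p e G = (if e ∈ G then 1 else 0) - p := by
    intro e
    unfold edgeDev
    split_ifs <;> ring
  simp only [dev, h, Finset.sum_sub_distrib, Finset.sum_boole, Finset.sum_const, nsmul_eq_mul]

lemma exGnp_dev {n : ℕ} (p : ℝ) (S : Finset (EdgeType n)) : exGnp n p (dev p S) = 0 := by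
  unfold dev
  rw [exGnp_sum]
  refine Finset.sum_eq_zero fun e _ => ?_
  simpa using exGnp_edgeDev_mul p e (fun _ => 1) (fun _ => rfl)

lemma exGnp_dev_sq {n : ℕ} (p : ℝ) (S : Finset (EdgeType n)) :
    exGnp n p (fun G => dev p S G ^ 2) = S.card * (p * (1 - p)) := by
  induction S using Finset.induction_on with
  | empty => simp [dev, exGnp]
  | insert e S he ih =>
    have h : ∀ G, dev p (insert e S) G ^ 2 =
        (edgeDev p e G ^ 2 * 1 + 2 * (edgeDev p e G * dev p S G)) + dev p S G ^ 2 := by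
      intro G
      rw [dev, Finset.sum_insert he, ← dev]
      ring
    simp only [h]
    rw [exGnp_add, exGnp_add, exGnp_const_mul, exGnp_edgeDev_pow_mul p e 2 (fun _ => 1)
      (fun _ => rfl), exGnp_edgeDev_mul p e _ (dev_congr p he), ih, exGnp_const,
      Finset.card_insert_of_notMem he]
    push_cast
    ring

lemma exGnp_dev_pow_four {n : ℕ} {p : ℝ} (h0 : 0 ≤ p) (h1 : p ≤ 1) (S : Finset (EdgeType n)) :
    exGnp n p (fun G => dev p S G ^ 4) ≤
      3 * (S.card * (p * (1 - p))) ^ 2 + S.card * (p * (1 - p)) := by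
  induction S using Finset.induction_on with
  | empty => simp [dev, exGnp]
  | insert e S he ih =>
    have h : ∀ G, dev p (insert e S) G ^ 4 =
        ((edgeDev p e G ^ 4 * 1 + 4 * (edgeDev p e G ^ 3 * dev p S G)) +
          (6 * (edgeDev p e G ^ 2 * dev p S G ^ 2) + 4 * (edgeDev p e G * dev p S G ^ 3)))
          + dev p S G ^ 4 := by
      intro G
      rw [dev, Finset.sum_insert he, ← dev]
      ring
    simp only [h]
    rw [exGnp_add, exGnp_add, exGnp_add, exGnp_add, exGnp_const_mul, exGnp_const_mul,
      exGnp_const_mul, exGnp_edgeDev_pow_mul p e 4 (fun _ => 1) (fun _ => rfl),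
      exGnp_edgeDev_pow_mul p e 3 _ (dev_congr p he),
      exGnp_edgeDev_pow_mul p e 2 (fun G => dev p S G ^ 2)
        (fun G => by rw [dev_congr p he]),
      exGnp_edgeDev_mul p e (fun G => dev p S G ^ 3) (fun G => by rw [dev_congr p he]),
      exGnp_dev, exGnp_dev_sq, exGnp_const, Finset.card_insert_of_notMem he]
    push_cast
    have hq : 0 ≤ p * (1 - p) := mul_nonneg h0 (sub_nonneg.2 h1)
    nlinarith [mul_nonneg hq hq, mul_nonneg hq (mul_nonneg h0 (sub_nonneg.2 h1)),
      mul_nonneg hq (sub_nonneg.2 h1)]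

lemma le_exGnp_abs_dev {n : ℕ} {p : ℝ} (h0 : 0 ≤ p) (h1 : p ≤ 1) (S : Finset (EdgeType n))
    (hV : 1 ≤ S.card * (p * (1 - p))) :
    √(S.card * (p * (1 - p))) / 2 ≤ exGnp n p (fun G => |dev p S G|) := by
  set V := S.card * (p * (1 - p)) with hVdef
  set K := √V with hK
  have hK1 : 1 ≤ K := Real.one_le_sqrt.2 hV
  have hK2 : K ^ 2 = V := Real.sq_sqrt (by linarith)
  have hKpos : 0 < K := by linarith
  have hpt : ∀ G, 3 / (4 * K) * dev p S G ^ 2 + (-(1 / (16 * K ^ 3))) * dev p S G ^ 4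
      ≤ |dev p S G| := by
    intro G
    have ht := abs_nonneg (dev p S G)
    rw [← sq_abs (dev p S G), ← (by decide : Even 4).pow_abs (dev p S G)]
    set t := |dev p S G|
    have : t - (3 / (4 * K) * t ^ 2 + (-(1 / (16 * K ^ 3))) * t ^ 4) =
        t * ((t - 2 * K) ^ 2 * (t + 4 * K)) / (16 * K ^ 3) := by
      field_simp
      ring
    have h2 : 0 ≤ t * ((t - 2 * K) ^ 2 * (t + 4 * K)) / (16 * K ^ 3) := by positivity
    linarith
  have h := exGnp_mono h0 h1 hpt
  rw [exGnp_add, exGnp_const_mul, exGnp_const_mul, exGnp_dev_sq, ← hVdef] at h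
  have h4 := exGnp_dev_pow_four h0 h1 S
  rw [← hVdef] at h4
  have h4' : exGnp n p (fun G => dev p S G ^ 4) ≤ 4 * K ^ 4 := by
    have : K ^ 4 = V ^ 2 := by rw [← hK2]; ring
    nlinarith
  refine le_trans ?_ h
  have h5 : 1 / (16 * K ^ 3) * exGnp n p (fun G => dev p S G ^ 4) ≤
      1 / (16 * K ^ 3) * (4 * K ^ 4) := mul_le_mul_of_nonneg_left h4' (by positivity)
  have h6 : 1 / (16 * K ^ 3) * (4 * K ^ 4) = K / 4 := by field_simp; norm_num
  have h7 : 3 / (4 * K) * V = 3 * K / 4 := by rw [← hK2]; field_simp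
  rw [h7]
  linarith

/-- The edge `e` is cut by `φ`. -/
def IsCut {n r : ℕ} (φ : Fin n → Fin r) (e : EdgeType n) : Prop :=
  ¬ (Sym2.map φ (e : Sym2 (Fin n))).IsDiag

/-- The relation on vertices given by a property of edges. -/
def PairRel {n : ℕ} (P : EdgeType n → Prop) (u v : Fin n) : Prop := ∃ h, P ⟨s(u, v), h⟩

/-- `φ` is a maximum `r`-cut of `G`. -/
def IsMaxCut {n r : ℕ} (φ : Fin n → Fin r) (G : EdgeGraph n) : Prop :=
  cutSize φ G = maxCut n r G

/-- The presence of `e` affects the size of the maximum `r`-cut. -/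
def Pivotal {n : ℕ} (r : ℕ) (G : EdgeGraph n) (e : EdgeType n) : Prop :=
  maxCut n r (insert e G) ≠ maxCut n r (G.erase e)

/-- The number of edges of `G` at `v`. -/
def edgeDeg {n : ℕ} (G : EdgeGraph n) (v : Fin n) : ℕ :=
  (G.filter fun e : EdgeType n => v ∈ (e : Sym2 (Fin n))).card

lemma isCut_mk {n r : ℕ} (φ : Fin n → Fin r) (u v : Fin n) (h : ¬ s(u, v).IsDiag) :
    IsCut φ ⟨s(u, v), h⟩ ↔ φ u ≠ φ v := by
  simp [IsCut]

lemma cutSize_def {n r : ℕ} (φ : Fin n → Fin r) (G : EdgeGraph n) :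
    cutSize φ G = (G.filter (IsCut φ)).card := by
  have h : (do let a ← G; pure (a : Sym2 (Fin n)) : Finset (Sym2 (Fin n))) =
      G.map (Function.Embedding.subtype _) := by
    ext e
    simp [Finset.bind_def, Finset.pure_def]
  unfold cutSize
  rw [h, Finset.filter_map, Finset.card_map]
  refine congrArg Finset.card (Finset.ext fun e => ?_)
  rw [Finset.mem_filter, Finset.mem_filter]
  rfl

lemma sum_card_eq_two_mul {n : ℕ} (P : EdgeType n → Prop) :
    ∑ u : Fin n, (Finset.univ.filter fun v => PairRel P u v).card =
      2 * (Finset.univ.filter P).card := by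
  let H : SimpleGraph (Fin n) :=
    { Adj := PairRel P
      symm := ⟨fun u v ⟨h, hP⟩ => by
        have : s(v, u) = s(u, v) := Sym2.eq_swap
        refine ⟨this ▸ h, ?_⟩
        simpa only [this] using hP⟩
      loopless := ⟨fun u ⟨h, _⟩ => h (by simp)⟩ }
  have h := H.sum_degrees_eq_twice_card_edges
  have h2 : H.edgeFinset.card = (Finset.univ.filter P).card := by
    rw [← Finset.card_map (Function.Embedding.subtype _)]
    congr 1
    ext e
    induction e with
    | _ u v =>
      simp only [SimpleGraph.mem_edgeFinset, SimpleGraph.mem_edgeSet, Finset.mem_map,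
        Finset.mem_filter, Finset.mem_univ, true_and, Function.Embedding.subtype_apply,
        Subtype.exists, exists_and_right, exists_eq_right]
      rfl
  rw [← h2, ← h]
  refine Finset.sum_congr rfl fun u _ => ?_
  rw [← SimpleGraph.card_neighborFinset_eq_degree]
  congr 1
  ext v
  simp [H]

lemma card_incident {n : ℕ} (P : EdgeType n → Prop) (w : Fin n) :
    (Finset.univ.filter fun e : EdgeType n => P e ∧ w ∈ (e : Sym2 (Fin n))).card =
      (Finset.univ.filter fun v => PairRel P w v).card := by
  symm
  refine Finset.card_bij (fun v hv => ⟨s(w, v), (Finset.mem_filter.1 hv).2.choose⟩) ?_ ?_ ?_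
  · intro v hv
    have := (Finset.mem_filter.1 hv).2
    exact Finset.mem_filter.2 ⟨Finset.mem_univ _, this.choose_spec, by simp⟩
  · intro v _ v' _ h
    exact Sym2.congr_right.1 (congrArg Subtype.val h)
  · rintro ⟨e, he⟩ hP
    obtain ⟨-, hP, hw⟩ := Finset.mem_filter.1 hP
    obtain ⟨v, rfl⟩ := Sym2.mem_iff_exists.1 hw
    exact ⟨v, Finset.mem_filter.2 ⟨Finset.mem_univ _, he, hP⟩, rfl⟩

lemma edgeDeg_eq {n : ℕ} (G : EdgeGraph n) (w : Fin n) :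
    edgeDeg G w = (Finset.univ.filter fun v => PairRel (· ∈ G) w v).card := by
  rw [← card_incident (fun e => e ∈ G), edgeDeg]
  congr 1
  ext e
  simp

lemma card_incident_le {n : ℕ} (w : Fin n) :
    (Finset.univ.filter fun e : EdgeType n => w ∈ (e : Sym2 (Fin n))).card ≤ n := by
  have h := card_incident (fun _ => True) w
  simp only [true_and] at h
  rw [h]
  exact (Finset.card_le_univ _).trans (by simp)

lemma two_mul_card_isCut {n r : ℕ} (φ : Fin n → Fin r) :
    (2 * (Finset.univ.filter (IsCut φ)).card : ℕ) +
      ∑ u, (Finset.univ.filter fun v => φ v = φ u).card = n * n := by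
  rw [← sum_card_eq_two_mul, ← Finset.sum_add_distrib]
  have : ∀ u, (Finset.univ.filter fun v => PairRel (IsCut φ) u v).card +
      (Finset.univ.filter fun v => φ v = φ u).card = n := by
    intro u
    have h1 : (Finset.univ.filter fun v => PairRel (IsCut φ) u v) =
        Finset.univ.filter fun v => ¬ φ v = φ u := by
      ext v
      simp only [PairRel, isCut_mk, Finset.mem_filter, Finset.mem_univ, true_and]
      constructor
      · rintro ⟨_, h⟩ h'
        exact h h'.symm
      · intro h
        refine ⟨?_, fun h' => h h'.symm⟩
        rw [Sym2.mk_isDiag_iff]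
        rintro rfl
        exact h rfl
    rw [h1, add_comm, Finset.card_filter_add_card_filter_not]
    simp
  rw [Finset.sum_congr rfl fun u _ => this u]
  simp

lemma card_isCut_le {n r : ℕ} (φ : Fin n → Fin r) :
    ((Finset.univ.filter (IsCut φ)).card : ℝ) ≤ (1 - 1 / (r : ℝ)) * n ^ 2 / 2 := by
  rcases Nat.eq_zero_or_pos r with rfl | hr
  · have hn : n = 0 := by
      rcases Nat.eq_zero_or_pos n with h | h
      · exact h
      · exact (φ ⟨0, h⟩).elim0
    subst hn
    have : (Finset.univ.filter (IsCut φ)).card = 0 :=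
      Nat.le_zero.1 ((Finset.card_le_univ _).trans (by rw [card_edgeType]; rfl))
    rw [this]
    simp
  have h := two_mul_card_isCut φ
  have hs : ∑ u, (Finset.univ.filter fun v => φ v = φ u).card =
      ∑ i : Fin r, (Finset.univ.filter fun v => φ v = i).card ^ 2 := by
    rw [← Finset.sum_fiberwise Finset.univ φ]
    refine Finset.sum_congr rfl fun i _ => ?_
    rw [Finset.sum_congr rfl (g := fun _ => (Finset.univ.filter fun v => φ v = i).card)]
    · rw [Finset.sum_const, smul_eq_mul, sq]
    · intro u hu
      rw [(Finset.mem_filter.1 hu).2]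
  have hn : ∑ i : Fin r, (Finset.univ.filter fun v => φ v = i).card = n := by
    rw [← Finset.card_eq_sum_card_fiberwise (fun _ _ => Finset.mem_univ _)]
    simp
  have hcs := sq_sum_le_card_mul_sum_sq (s := (Finset.univ : Finset (Fin r)))
    (f := fun i => (Finset.univ.filter fun v => φ v = i).card)
  rw [hn, ← hs, Finset.card_univ, Fintype.card_fin] at hcs
  set A := ∑ u, (Finset.univ.filter fun v => φ v = φ u).card
  have hr' : (0 : ℝ) < r := by exact_mod_cast hr
  have h' : (2 * ((Finset.univ.filter (IsCut φ)).card : ℝ)) + A = n * n := by exact_mod_cast h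
  have hcs' : (n : ℝ) ^ 2 ≤ r * A := by exact_mod_cast hcs
  have : (n : ℝ) ^ 2 / r ≤ A := by
    rw [div_le_iff₀ hr']
    linarith
  have e : (1 - 1 / (r : ℝ)) * n ^ 2 / 2 = (n ^ 2 - n ^ 2 / r) / 2 := by ring
  rw [e]
  linarith

lemma le_card_isCut {n r : ℕ} (φ : Fin n → Fin r)
    (hφ : ∀ i, (Finset.univ.filter fun v => φ v = i).card ≤ n / r + 1) :
    (1 - 1 / (r : ℝ)) * n ^ 2 / 2 - n / 2 ≤ ((Finset.univ.filter (IsCut φ)).card : ℝ) := by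
  have h := two_mul_card_isCut φ
  have hs : ∑ u, (Finset.univ.filter fun v => φ v = φ u).card ≤ n * (n / r + 1) := by
    refine (Finset.sum_le_sum fun u _ => hφ (φ u)).trans ?_
    simp
  set A := ∑ u, (Finset.univ.filter fun v => φ v = φ u).card
  have h' : (2 * ((Finset.univ.filter (IsCut φ)).card : ℝ)) + A = n * n := by exact_mod_cast h
  have hs' : (A : ℝ) ≤ n * (((n / r : ℕ) : ℝ) + 1) := by exact_mod_cast hs
  have hd : ((n / r : ℕ) : ℝ) ≤ n / r := Nat.cast_div_le
  have : (n : ℝ) * (((n / r : ℕ) : ℝ) + 1) ≤ n * (n / r + 1) := by gcongr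
  have e : (1 - 1 / (r : ℝ)) * n ^ 2 / 2 = (n * n - n * (n / r + 1) + n) / 2 := by ring
  rw [e]
  linarith

lemma cutSize_le_maxCut {n r : ℕ} (φ : Fin n → Fin r) (G : EdgeGraph n) :
    cutSize φ G ≤ maxCut n r G :=
  Finset.le_sup (f := fun φ : Fin n → Fin r => cutSize φ G) (Finset.mem_univ φ)

lemma exists_isMaxCut {n r : ℕ} [NeZero r] (G : EdgeGraph n) :
    ∃ φ : Fin n → Fin r, IsMaxCut φ G := by
  obtain ⟨φ, -, h⟩ := Finset.exists_mem_eq_sup (Finset.univ : Finset (Fin n → Fin r))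
    Finset.univ_nonempty (fun φ => cutSize φ G)
  exact ⟨φ, h.symm⟩

lemma isMaxCut_of_le {n r : ℕ} {φ : Fin n → Fin r} {G : EdgeGraph n}
    (h : maxCut n r G ≤ cutSize φ G) : IsMaxCut φ G :=
  le_antisymm (cutSize_le_maxCut φ G) h

lemma eqvV_zero_iff {n r : ℕ} {G : EdgeGraph n} {u v : Fin n} :
    EqvV 0 r G u v ↔ ∀ φ : Fin n → Fin r, IsMaxCut φ G → φ u = φ v := by
  refine forall_congr' fun φ => ?_
  have h := cutSize_le_maxCut φ G
  have : deficit r φ G ≤ 0 ↔ IsMaxCut φ G := by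
    unfold deficit IsMaxCut
    omega
  rw [this]

lemma cutSize_insert {n r : ℕ} (φ : Fin n → Fin r) (G : EdgeGraph n) (e : EdgeType n)
    (he : e ∉ G) : cutSize φ (insert e G) = cutSize φ G + if IsCut φ e then 1 else 0 := by
  rw [cutSize_def, cutSize_def, Finset.filter_insert]
  split_ifs with h
  · rw [Finset.card_insert_of_notMem (by simp [he])]
  · rfl

lemma cutSize_erase {n r : ℕ} (φ : Fin n → Fin r) (G : EdgeGraph n) (e : EdgeType n)
    (he : e ∈ G) : cutSize φ G = cutSize φ (G.erase e) + if IsCut φ e then 1 else 0 := by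
  rw [← cutSize_insert φ _ e (Finset.notMem_erase e G), Finset.insert_erase he]

/-- An edge of `G` is pivotal if and only if every maximum cut cuts it. -/
lemma pivotal_iff_of_mem {n r : ℕ} [NeZero r] {G : EdgeGraph n} {e : EdgeType n} (he : e ∈ G) :
    Pivotal r G e ↔ ∀ φ : Fin n → Fin r, IsMaxCut φ G → IsCut φ e := by
  rw [Pivotal, Finset.insert_eq_of_mem he]
  constructor
  · intro h φ hφ
    by_contra hc
    have h1 := cutSize_erase φ G e he
    rw [if_neg hc] at h1
    have h2 := cutSize_le_maxCut φ (G.erase e)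
    obtain ⟨ψ, hψ⟩ := exists_isMaxCut (r := r) (G.erase e)
    have h3 := cutSize_erase ψ G e he
    have h4 := cutSize_le_maxCut ψ G
    unfold IsMaxCut at hφ hψ
    omega
  · intro h hm
    obtain ⟨φ, hφ⟩ := exists_isMaxCut (r := r) (G.erase e)
    have h1 := cutSize_erase φ G e he
    have h2 := cutSize_le_maxCut φ G
    unfold IsMaxCut at hφ
    have hc := h φ (isMaxCut_of_le (by omega))
    rw [if_pos hc] at h1
    omega

lemma Pivotal.exists_isCut {n r : ℕ} [NeZero r] {G : EdgeGraph n} {e : EdgeType n}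
    (h : Pivotal r G e) : ∃ φ : Fin n → Fin r, IsMaxCut φ G ∧ IsCut φ e := by
  by_cases he : e ∈ G
  · obtain ⟨φ, hφ⟩ := exists_isMaxCut (r := r) G
    exact ⟨φ, hφ, (pivotal_iff_of_mem he).1 h φ hφ⟩
  · rw [Pivotal, Finset.erase_eq_of_notMem he] at h
    obtain ⟨φ, hφ⟩ := exists_isMaxCut (r := r) (insert e G)
    have h1 := cutSize_insert φ G e he
    have h2 := cutSize_le_maxCut φ G
    obtain ⟨ψ, hψ⟩ := exists_isMaxCut (r := r) G
    have h3 := cutSize_insert ψ G e he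
    have h4 := cutSize_le_maxCut ψ (insert e G)
    unfold IsMaxCut at hφ hψ
    split_ifs at h1 with hc
    · exact ⟨φ, isMaxCut_of_le (by omega), hc⟩
    · omega

lemma pivotal_congr {n r : ℕ} (G : EdgeGraph n) (e : EdgeType n) :
    Pivotal r (insert e G) e ↔ Pivotal r (G.erase e) e := by
  have h : insert e (G.erase e) = insert e G := by
    ext x
    by_cases hx : x = e <;> simp [hx]
  rw [Pivotal, Pivotal, Finset.insert_idem, Finset.erase_insert_eq_erase, h, Finset.erase_idem]

/-- In a maximum cut, no vertex has more neighbours in its own part than in another part. -/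
lemma IsMaxCut.card_own_le {n r : ℕ} {φ : Fin n → Fin r} {G : EdgeGraph n} (hφ : IsMaxCut φ G)
    (w : Fin n) (c : Fin r) :
    (Finset.univ.filter fun v => PairRel (· ∈ G) w v ∧ φ v = φ w).card ≤
      (Finset.univ.filter fun v => PairRel (· ∈ G) w v ∧ φ v = c).card := by
  have hsplit : ∀ ψ : Fin n → Fin r, cutSize ψ G =
      (G.filter fun e : EdgeType n => IsCut ψ e ∧ w ∉ (e : Sym2 (Fin n))).card +
      (Finset.univ.filter fun v =>
        PairRel (· ∈ G) w v ∧ ψ v ≠ ψ w).card := by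
    intro ψ
    have h1 := card_incident (fun e => e ∈ G ∧ IsCut ψ e) w
    have h2 : (Finset.univ.filter fun v => PairRel (fun e => e ∈ G ∧ IsCut ψ e) w v) = Finset.univ.filter fun v =>
        PairRel (· ∈ G) w v ∧ ψ v ≠ ψ w := by
      ext v
      simp only [PairRel, isCut_mk, Finset.mem_filter, Finset.mem_univ, true_and, ne_comm (a := ψ w)]
      exact ⟨fun ⟨h, h1, h2⟩ => ⟨⟨h, h1⟩, h2⟩, fun ⟨⟨h, h1⟩, h2⟩ => ⟨h, h1, h2⟩⟩
    rw [← h2, ← h1, cutSize_def,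
      ← Finset.card_filter_add_card_filter_not (fun e : EdgeType n => w ∉ (e : Sym2 (Fin n))),
      Finset.filter_filter, Finset.filter_filter]
    congr 2
    ext e
    simp [and_assoc]
  by_cases hc : c = φ w
  · rw [hc]
  have hdeg : ∀ d : Fin r,
      (Finset.univ.filter fun v => PairRel (· ∈ G) w v ∧ φ v = d).card +
      (Finset.univ.filter fun v => PairRel (· ∈ G) w v ∧ φ v ≠ d).card =
      edgeDeg G w := by
    intro d
    rw [edgeDeg_eq, ← Finset.card_filter_add_card_filter_not
      (s := Finset.univ.filter fun v => PairRel (· ∈ G) w v) (fun v => φ v = d),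
      Finset.filter_filter, Finset.filter_filter]
  have hle := cutSize_le_maxCut (Function.update φ w c) G
  rw [← hφ, hsplit, hsplit φ] at hle
  have e1 : (G.filter fun e : EdgeType n => IsCut (Function.update φ w c) e ∧ w ∉ (e : Sym2 (Fin n))) =
      G.filter fun e : EdgeType n => IsCut φ e ∧ w ∉ (e : Sym2 (Fin n)) := by
    refine Finset.filter_congr fun e _ => and_congr_left fun hw => ?_
    obtain ⟨e, he⟩ := e
    induction e with
    | _ u v =>
      simp only [Sym2.mem_iff, not_or] at hw
      rw [isCut_mk, isCut_mk, Function.update_of_ne (Ne.symm hw.1),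
        Function.update_of_ne (Ne.symm hw.2)]
  have e2 : (Finset.univ.filter fun v => PairRel (· ∈ G) w v ∧
      Function.update φ w c v ≠ Function.update φ w c w) =
      Finset.univ.filter fun v => PairRel (· ∈ G) w v ∧ φ v ≠ c := by
    refine Finset.filter_congr fun v _ => and_congr_right fun ⟨h, _⟩ => ?_
    have hv : v ≠ w := by
      rintro rfl
      exact h (by simp)
    rw [Function.update_self, Function.update_of_ne hv]
  rw [e1, e2] at hle
  have h1 := hdeg c
  have h2 := hdeg (φ w)
  omega

lemma EqvV.refl {n d r : ℕ} (G : EdgeGraph n) (u : Fin n) : EqvV d r G u u := fun _ _ => rfl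

lemma EqvV.symm {n d r : ℕ} {G : EdgeGraph n} {u v : Fin n} (h : EqvV d r G u v) :
    EqvV d r G v u := fun φ hφ => (h φ hφ).symm

lemma EqvV.trans {n d r : ℕ} {G : EdgeGraph n} {u v w : Fin n} (h : EqvV d r G u v)
    (h' : EqvV d r G v w) : EqvV d r G u w := fun φ hφ => (h φ hφ).trans (h' φ hφ)

lemma component_eq_iff {n d r : ℕ} {G : EdgeGraph n} {u v : Fin n} :
    component d r G u = component d r G v ↔ EqvV d r G u v := by
  constructor
  · intro h
    have : v ∈ component d r G v := Finset.mem_filter.2 ⟨Finset.mem_univ _, EqvV.refl G v⟩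
    rw [← h] at this
    exact (Finset.mem_filter.1 this).2
  · intro h
    exact Finset.filter_congr fun w _ => ⟨fun h' => h.symm.trans h', fun h' => h.trans h'⟩

/-- The vertices outside of the `(0,r)`-core. -/
def outside {n : ℕ} (r : ℕ) (G : EdgeGraph n) : Finset (Fin n) :=
  if HasCore 0 r G then
    Finset.univ.filter fun v : Fin n =>
      ¬ ((n : ℝ) / (r + 1)) < ((component 0 r G v).card : ℝ)
  else Finset.univ

lemma xr_eq_card_outside {n : ℕ} (r : ℕ) (G : EdgeGraph n) : xr r G = (outside r G).card := by
  unfold xr outside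
  split_ifs <;> simp

lemma exists_coreColouring {n r : ℕ} [NeZero r] {G : EdgeGraph n} (hG : HasCore 0 r G) :
    ∃ ψ : Fin n → Fin r,
      (∀ u v, u ∉ outside r G → v ∉ outside r G → (ψ u = ψ v ↔ EqvV 0 r G u v)) ∧
      ∀ i, ∃ v, v ∉ outside r G ∧ ψ v = i := by
  have hmem : ∀ v, v ∉ outside r G ↔ component 0 r G v ∈ coreSets 0 r G := by
    intro v
    simp [outside, if_pos hG, coreSets]
  let E := Finset.equivFinOfCardEq hG
  refine ⟨fun v => if h : component 0 r G v ∈ coreSets 0 r G then E ⟨_, h⟩ else 0, ?_, ?_⟩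
  · intro u v hu hv
    rw [hmem] at hu hv
    simp only [dif_pos hu, dif_pos hv, E.apply_eq_iff_eq, Subtype.mk.injEq]
    exact component_eq_iff
  · intro i
    obtain ⟨⟨S, hS⟩, rfl⟩ := E.surjective i
    obtain ⟨v, -, rfl⟩ := Finset.mem_image.1 (Finset.mem_filter.1 hS).1
    exact ⟨v, (hmem v).2 hS, dif_pos hS⟩

lemma card_pivotal_le {n r : ℕ} [NeZero r] (G : EdgeGraph n) :
    ((Finset.univ.filter (Pivotal r G)).card : ℝ) ≤
      (1 - 1 / (r : ℝ)) * n ^ 2 / 2 + n * xr r G := by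
  have hinc : (((outside r G).biUnion fun w =>
      Finset.univ.filter fun e : EdgeType n => w ∈ (e : Sym2 (Fin n))).card : ℝ) ≤
      n * xr r G := by
    rw [xr_eq_card_outside]
    have h : ((outside r G).biUnion fun w =>
      Finset.univ.filter fun e : EdgeType n => w ∈ (e : Sym2 (Fin n))).card ≤
      (outside r G).card * n :=
      Finset.card_biUnion_le_card_mul _ _ _ fun w _ => card_incident_le w
    rw [mul_comm]
    exact_mod_cast h
  obtain ⟨ψ, hψ⟩ : ∃ ψ : Fin n → Fin r, ∀ u v, u ∉ outside r G → v ∉ outside r G →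
      ψ u = ψ v → EqvV 0 r G u v := by
    by_cases hG : HasCore 0 r G
    · obtain ⟨ψ, hψ, -⟩ := exists_coreColouring hG
      exact ⟨ψ, fun u v hu hv => (hψ u v hu hv).1⟩
    · exact ⟨fun _ => 0, fun u v hu => by simp [outside, if_neg hG] at hu⟩
  have hsub : Finset.univ.filter (Pivotal r G) ⊆ Finset.univ.filter (IsCut ψ) ∪
      (outside r G).biUnion fun w =>
        Finset.univ.filter fun e : EdgeType n => w ∈ (e : Sym2 (Fin n)) := by
    intro e he
    obtain ⟨φ, hφ, hc⟩ := (Finset.mem_filter.1 he).2.exists_isCut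
    obtain ⟨e, hd⟩ := e
    induction e with
    | _ u v =>
      rw [Finset.mem_union, Finset.mem_biUnion]
      by_cases hu : u ∈ outside r G
      · exact Or.inr ⟨u, hu, by simp⟩
      by_cases hv : v ∈ outside r G
      · exact Or.inr ⟨v, hv, by simp⟩
      refine Or.inl (Finset.mem_filter.2 ⟨Finset.mem_univ _, ?_⟩)
      rw [isCut_mk] at hc ⊢
      exact fun h => hc (eqvV_zero_iff.1 (hψ u v hu hv h) φ hφ)
  have h1 := (Finset.card_le_card hsub).trans (Finset.card_union_le _ _)
  have h2 := card_isCut_le ψ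
  have h3 : ((Finset.univ.filter (Pivotal r G)).card : ℝ) ≤ _ := Nat.cast_le.2 h1
  push_cast at h3
  linarith

lemma exists_part_subset_outside {n r : ℕ} {G : EdgeGraph n} {ψ φ : Fin n → Fin r}
    (hψ : ∀ u v, u ∉ outside r G → v ∉ outside r G → (ψ u = ψ v ↔ EqvV 0 r G u v))
    (hsurj : ∀ i, ∃ v, v ∉ outside r G ∧ ψ v = i) (hφ : IsMaxCut φ G) {u v : Fin n}
    (hu : u ∉ outside r G) (hv : v ∉ outside r G) (huv : ψ u ≠ ψ v) (h : φ u = φ v) :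
    ∃ c, ∀ w, φ w = c → w ∈ outside r G := by
  choose ρ hρ hρψ using hsurj
  have hrep : ∀ w, w ∉ outside r G → φ (ρ (ψ w)) = φ w := fun w hw =>
    eqvV_zero_iff.1 ((hψ _ _ (hρ _) hw).1 (hρψ _)) φ hφ
  have hinj : ¬ Function.Surjective fun i => φ (ρ i) := by
    rw [← Finite.injective_iff_surjective]
    intro hi
    exact huv (hi (by simp only [hrep u hu, hrep v hv, h]))
  rw [Function.Surjective] at hinj
  push Not at hinj
  obtain ⟨c, hc⟩ := hinj
  refine ⟨c, fun w hw => ?_⟩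
  by_contra hout
  exact hc (ψ w) ((hrep w hout).trans hw)

lemma maxCut_le {n r : ℕ} [NeZero r] (G : EdgeGraph n) :
    maxCut n r G ≤ (G.filter (Pivotal r G)).card +
      (r + 1) * ∑ x ∈ outside r G, edgeDeg G x := by
  obtain ⟨φ, hφ⟩ := exists_isMaxCut (r := r) G
  rw [← hφ, cutSize_def]
  have htouch : ((outside r G).biUnion fun w =>
      G.filter fun e : EdgeType n => w ∈ (e : Sym2 (Fin n))).card ≤
      ∑ x ∈ outside r G, edgeDeg G x := Finset.card_biUnion_le
  obtain ⟨bad, hbad_iff⟩ : ∃ bad : EdgeType n → Prop, ∀ e, bad e ↔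
      (e ∈ G ∧ IsCut φ e) ∧ ¬ Pivotal r G e ∧ ∀ w ∈ (e : Sym2 (Fin n)), w ∉ outside r G :=
    ⟨_, fun _ => Iff.rfl⟩
  have hsub : G.filter (IsCut φ) ⊆ (G.filter (Pivotal r G) ∪ (outside r G).biUnion fun w =>
      G.filter fun e : EdgeType n => w ∈ (e : Sym2 (Fin n))) ∪ Finset.univ.filter bad := by
    intro e he
    obtain ⟨heG, hec⟩ := Finset.mem_filter.1 he
    simp only [Finset.mem_union, Finset.mem_filter, Finset.mem_biUnion, Finset.mem_univ,
      true_and, hbad_iff]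
    by_cases hp : Pivotal r G e
    · exact Or.inl (Or.inl ⟨heG, hp⟩)
    by_cases hw : ∃ w ∈ outside r G, w ∈ (e : Sym2 (Fin n))
    · obtain ⟨w, h1, h2⟩ := hw
      exact Or.inl (Or.inr ⟨w, h1, heG, h2⟩)
    · exact Or.inr ⟨⟨heG, hec⟩, hp, fun w h1 h2 => hw ⟨w, h2, h1⟩⟩
  have hbad : (Finset.univ.filter bad).card ≤ r * ∑ x ∈ outside r G, edgeDeg G x := by
    by_cases hG : HasCore 0 r G
    swap
    · have : Finset.univ.filter bad = ∅ := by
        refine Finset.filter_eq_empty_iff.2 fun e _ hb => ?_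
        rw [hbad_iff] at hb
        obtain ⟨e, hd⟩ := e
        induction e with
        | _ u v => exact hb.2.2 u (by simp) (by simp [outside, if_neg hG])
      simp [this]
    obtain ⟨ψ, hψ, hsurj⟩ := exists_coreColouring hG
    have hvert : ∀ u, (Finset.univ.filter fun v => PairRel bad u v).card ≤
        r * ((outside r G).filter fun x => PairRel (· ∈ G) u x).card := by
      intro u
      rw [Finset.card_eq_sum_card_fiberwise (f := ψ) (t := Finset.univ)
        (fun _ _ => Finset.mem_univ _)]
      refine (Finset.sum_le_card_nsmul _ _
        ((outside r G).filter fun x => PairRel (· ∈ G) u x).card fun j _ => ?_).trans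
        (by simp)
      rcases Finset.eq_empty_or_nonempty
        ((Finset.univ.filter fun v => PairRel bad u v).filter fun v => ψ v = j) with h0 | ⟨v, hv⟩
      · rw [h0]
        simp
      obtain ⟨hvu, rfl⟩ := Finset.mem_filter.1 hv
      obtain ⟨hd, hb⟩ := (Finset.mem_filter.1 hvu).2
      obtain ⟨⟨heG, hec⟩, hp, hout⟩ := (hbad_iff _).1 hb
      have hu : u ∉ outside r G := hout u (by simp)
      have hvo : v ∉ outside r G := hout v (by simp)
      rw [pivotal_iff_of_mem heG] at hp
      push Not at hp
      obtain ⟨φ', hφ', hc'⟩ := hp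
      rw [isCut_mk, not_not] at hc'
      rw [isCut_mk] at hec
      have hne : ψ u ≠ ψ v := fun h => hec (eqvV_zero_iff.1 ((hψ u v hu hvo).1 h) φ hφ)
      obtain ⟨c, hc⟩ := exists_part_subset_outside hψ hsurj hφ' hu hvo hne hc'
      refine (Finset.card_le_card ?_).trans ((hφ'.card_own_le u c).trans
        (Finset.card_le_card ?_))
      · intro w hw
        obtain ⟨hw, hwv⟩ := Finset.mem_filter.1 hw
        obtain ⟨hdw, hbw⟩ := (Finset.mem_filter.1 hw).2
        obtain ⟨⟨hwG, -⟩, -, hwo⟩ := (hbad_iff _).1 hbw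
        refine Finset.mem_filter.2 ⟨Finset.mem_univ _, ⟨hdw, hwG⟩, ?_⟩
        rw [hc']
        exact eqvV_zero_iff.1 ((hψ w v (hwo w (by simp)) hvo).1 hwv) φ' hφ'
      · intro w hw
        obtain ⟨-, hadj, hwc⟩ := Finset.mem_filter.1 hw
        exact Finset.mem_filter.2 ⟨hc w hwc, hadj⟩
    have hsymm : ∀ u v, PairRel (· ∈ G) u v → PairRel (· ∈ G) v u := by
      rintro u v ⟨hd, h⟩
      have : s(v, u) = s(u, v) := Sym2.eq_swap
      refine ⟨this ▸ hd, ?_⟩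
      simpa only [this] using h
    have hdouble : ∑ u, ((outside r G).filter fun x => PairRel (· ∈ G) u x).card =
        ∑ x ∈ outside r G, edgeDeg G x := by
      simp only [Finset.card_filter, edgeDeg_eq]
      rw [Finset.sum_comm]
      refine Finset.sum_congr rfl fun x _ => Finset.sum_congr rfl fun u _ => ?_
      exact if_congr ⟨hsymm u x, hsymm x u⟩ rfl rfl
    have h1 := Finset.sum_le_sum fun u (_ : u ∈ (Finset.univ : Finset (Fin n))) => hvert u
    rw [sum_card_eq_two_mul, ← Finset.mul_sum, hdouble] at h1
    omega
  have h1 := (Finset.card_le_card hsub).trans (Finset.card_union_le _ _)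
  have h2 := Finset.card_union_le (G.filter (Pivotal r G)) ((outside r G).biUnion fun w =>
      G.filter fun e : EdgeType n => w ∈ (e : Sym2 (Fin n)))
  rw [add_mul, one_mul]
  omega

lemma exGnp_sum_edgeDeg_outside_le {n r : ℕ} {p : ℝ} (h0 : 0 ≤ p) (h1 : p ≤ 1)
    (hnp : 0 < n * p) :
    exGnp n p (fun G => ∑ x ∈ outside r G, (edgeDeg G x : ℝ)) ≤
      2 * (n * p) * exGnp n p (fun G => (xr r G : ℝ)) + n / 4 := by
  let inc : Fin n → Finset (EdgeType n) := fun x =>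
    Finset.univ.filter fun e : EdgeType n => x ∈ (e : Sym2 (Fin n))
  have hn' : (n : ℝ) ≠ 0 := (pos_of_mul_pos_left hnp h0).ne'
  have hp' : p ≠ 0 := (pos_of_mul_pos_right hnp n.cast_nonneg).ne'
  have hinc : ∀ x, ((inc x).card : ℝ) * p ≤ n * p := fun x =>
    mul_le_mul_of_nonneg_right (Nat.cast_le.2 (card_incident_le x)) h0
  have hpt : ∀ G : EdgeGraph n, ∑ x ∈ outside r G, (edgeDeg G x : ℝ) ≤
      2 * (n * p) * (xr r G : ℝ) + ∑ x, 1 / (4 * (n * p)) * dev p (inc x) G ^ 2 := by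
    intro G
    have hdeg : ∀ x, (edgeDeg G x : ℝ) ≤
        2 * (n * p) + 1 / (4 * (n * p)) * dev p (inc x) G ^ 2 := by
      intro x
      have h := dev_eq p (inc x) G
      have hd : ((inc x).filter (· ∈ G)).card = edgeDeg G x := by
        rw [edgeDeg]
        congr 1
        ext e
        simp [inc, and_comm]
      rw [hd] at h
      have h2 := hinc x
      set d := dev p (inc x) G
      have h3 : n * p - d + 1 / (4 * (n * p)) * d ^ 2 =
          (d - 2 * (n * p)) ^ 2 / (4 * (n * p)) := by
        field_simp
        ring
      have h4 : 0 ≤ (d - 2 * (n * p)) ^ 2 / (4 * (n * p)) := by positivity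
      linarith
    calc ∑ x ∈ outside r G, (edgeDeg G x : ℝ)
        ≤ ∑ x ∈ outside r G, (2 * (n * p) + 1 / (4 * (n * p)) * dev p (inc x) G ^ 2) :=
          Finset.sum_le_sum fun x _ => hdeg x
      _ = 2 * (n * p) * (xr r G : ℝ) +
          ∑ x ∈ outside r G, 1 / (4 * (n * p)) * dev p (inc x) G ^ 2 := by
          rw [Finset.sum_add_distrib, xr_eq_card_outside, Finset.sum_const, nsmul_eq_mul,
            mul_comm]
      _ ≤ _ := by
          gcongr
          exact Finset.subset_univ _
  refine (exGnp_mono h0 h1 hpt).trans ?_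
  rw [exGnp_add, exGnp_const_mul, exGnp_sum]
  gcongr
  have hx : ∀ x ∈ (Finset.univ : Finset (Fin n)),
      exGnp n p (fun G => 1 / (4 * (n * p)) * dev p (inc x) G ^ 2) ≤ 1 / 4 := by
    intro x _
    rw [exGnp_const_mul, exGnp_dev_sq]
    have h2 : ((inc x).card : ℝ) * (p * (1 - p)) ≤ n * p := by
      have := mul_le_mul (hinc x) (by linarith : 1 - p ≤ 1) (by linarith) hnp.le
      linarith
    calc 1 / (4 * (n * p)) * (((inc x).card : ℝ) * (p * (1 - p)))
        ≤ 1 / (4 * (n * p)) * (n * p) := by gcongr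
      _ = 1 / 4 := by field_simp
  refine (Finset.sum_le_sum hx).trans (le_of_eq ?_)
  simp
  ring

lemma exGnp_maxCut_le {n r : ℕ} [NeZero r] {p : ℝ} (h0 : 0 ≤ p) (h1 : p ≤ 1)
    (hnp : 0 < n * p) :
    exGnp n p (fun G => (maxCut n r G : ℝ)) ≤
      p * ((1 - 1 / (r : ℝ)) * n ^ 2 / 2) + (r + 1) * n / 4 +
        (2 * r + 3) * (n * p) * exGnp n p (fun G => (xr r G : ℝ)) := by
  have hpiv : exGnp n p (fun G => ((G.filter (Pivotal r G)).card : ℝ)) =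
      p * exGnp n p (fun G => ((Finset.univ.filter (Pivotal r G)).card : ℝ)) := by
    have e1 : ∀ G : EdgeGraph n, ((G.filter (Pivotal r G)).card : ℝ) =
        ∑ e, (if e ∈ G then 1 else 0) * (if Pivotal r G e then (1 : ℝ) else 0) := by
      intro G
      simp only [ite_mul, one_mul, zero_mul]
      rw [Finset.sum_ite_mem, Finset.univ_inter, Finset.sum_boole]
    have e2 : ∀ G : EdgeGraph n, ((Finset.univ.filter (Pivotal r G)).card : ℝ) =
        ∑ e, (if Pivotal r G e then (1 : ℝ) else 0) := by
      intro G
      rw [Finset.sum_boole]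
    simp only [e1, e2]
    rw [exGnp_sum, exGnp_sum, Finset.mul_sum]
    refine Finset.sum_congr rfl fun e _ => ?_
    rw [exGnp_ite_mul p e 1 0 (fun G => if Pivotal r G e then (1 : ℝ) else 0)
      fun G => if_congr (pivotal_congr G e) rfl rfl]
    ring
  have hpiv2 := exGnp_mono h0 h1 (card_pivotal_le (n := n) (r := r))
  rw [exGnp_add, exGnp_const, exGnp_const_mul] at hpiv2
  have hdeg := exGnp_sum_edgeDeg_outside_le (r := r) h0 h1 hnp
  have hmax : ∀ G : EdgeGraph n, (maxCut n r G : ℝ) ≤ ((G.filter (Pivotal r G)).card : ℝ) +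
      (r + 1) * ∑ x ∈ outside r G, (edgeDeg G x : ℝ) := by
    intro G
    exact_mod_cast maxCut_le G
  have h := exGnp_mono h0 h1 hmax
  rw [exGnp_add, exGnp_const_mul, hpiv] at h
  have h2 := mul_le_mul_of_nonneg_left hpiv2 h0
  have h3 := mul_le_mul_of_nonneg_left hdeg (by positivity : (0 : ℝ) ≤ r + 1)
  linarith

/-- The partition of `Fin n` by residues modulo `r`, with `r * t` and `r * t + 1` interchanged
for all `t < m` satisfying `s t`. -/
def flipCut (n : ℕ) {r : ℕ} (hr : 2 ≤ r) (m : ℕ) (s : ℕ → Prop) (v : Fin n) : Fin r :=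
  if (v : ℕ) / r < m ∧ s (v / r) then
    Equiv.swap ⟨0, by omega⟩ ⟨1, by omega⟩ (⟨v % r, Nat.mod_lt _ (by omega)⟩ : Fin r)
  else ⟨v % r, Nat.mod_lt _ (by omega)⟩

lemma card_fiber_flipCut_le (n : ℕ) {r : ℕ} (hr : 2 ≤ r) (m : ℕ) (s : ℕ → Prop) (i : Fin r) :
    (Finset.univ.filter fun v => flipCut n hr m s v = i).card ≤ n / r + 1 := by
  rw [← Finset.card_range (n / r + 1)]
  refine Finset.card_le_card_of_injOn (fun v => (v : ℕ) / r) ?_ ?_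
  · intro v _
    simpa [Nat.lt_succ_iff] using Nat.div_le_div_right v.2.le
  · intro v hv w hw h
    have hvw : flipCut n hr m s v = flipCut n hr m s w := by
      rw [(Finset.mem_filter.1 hv).2, (Finset.mem_filter.1 hw).2]
    simp only at h
    have hmod : (v : ℕ) % r = w % r := by
      unfold flipCut at hvw
      rw [h] at hvw
      split_ifs at hvw
      · simpa using hvw
      · simpa using hvw
    rw [Fin.ext_iff, ← Nat.div_add_mod (v : ℕ) r, ← Nat.div_add_mod (w : ℕ) r, h, hmod]

/-- The edges between `r * t` and the vertices `r * k + 1` with `m ≤ k < 2 * m`. -/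
def starEdges (n r m t : ℕ) : Finset (EdgeType n) :=
  Finset.univ.filter fun e : EdgeType n => ∃ u w : Fin n, (e : Sym2 (Fin n)) = s(u, w) ∧
    (u : ℕ) = r * t ∧ (w : ℕ) % r = 1 ∧ m ≤ (w : ℕ) / r ∧ (w : ℕ) / r < 2 * m

lemma disjoint_starEdges (n : ℕ) {r : ℕ} (m : ℕ) {t t' : ℕ} (hr : 2 ≤ r) (h : t ≠ t') :
    Disjoint (starEdges n r m t) (starEdges n r m t') := by
  rw [Finset.disjoint_left]
  intro e he he'
  obtain ⟨u, w, huw, hu, hw, -⟩ := (Finset.mem_filter.1 he).2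
  obtain ⟨u', w', huw', hu', hw', -⟩ := (Finset.mem_filter.1 he').2
  rw [huw] at huw'
  rcases Sym2.eq_iff.1 huw' with ⟨rfl, -⟩ | ⟨rfl, -⟩
  · exact h (Nat.eq_of_mul_eq_mul_left (by omega) (hu.symm.trans hu'))
  · rw [hu, Nat.mul_mod_right] at hw'
    omega

lemma le_card_starEdges {n r m t : ℕ} (hr : 2 ≤ r) (hm : 2 * m * r ≤ n) (ht : t < m) :
    m ≤ (starEdges n r m t).card := by
  have hlt : ∀ k < 2 * m, r * k + 1 < n := by
    intro k hk
    have : r * (k + 1) ≤ r * (2 * m) := Nat.mul_le_mul_left r hk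
    rw [mul_add, mul_comm r (2 * m)] at this
    omega
  have hmod : ∀ k, (r * k + 1) % r = 1 := fun k => by
    rw [Nat.mul_add_mod, Nat.mod_eq_of_lt (by omega)]
  have hdiv : ∀ k, (r * k + 1) / r = k := fun k => by
    rw [Nat.mul_add_div (by omega), Nat.div_eq_of_lt (by omega), add_zero]
  have hu := hlt t (by omega)
  let u : Fin n := ⟨r * t, by omega⟩
  let w : Fin m → Fin n := fun k => ⟨r * (m + k) + 1, hlt _ (by omega)⟩
  have hd : ∀ k, ¬ s(u, w k).IsDiag := by
    intro k hk
    rw [Sym2.mk_isDiag_iff] at hk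
    have h1 := congrArg (fun v : Fin n => (v : ℕ) % r) hk
    simp only [u, w, Nat.mul_mod_right, hmod] at h1
    omega
  refine (Finset.card_fin m).symm.le.trans (Finset.card_le_card_of_injOn (s := (Finset.univ : Finset (Fin m))) (fun k => (⟨s(u, w k), hd k⟩ : EdgeType n)) ?_ ?_)
  · intro k _
    refine Finset.mem_coe.2 (Finset.mem_filter.2
      ⟨Finset.mem_univ _, u, w k, rfl, rfl, hmod _, ?_, ?_⟩)
    · simp only [w, hdiv]
      omega
    · simp only [w, hdiv]
      omega
  · intro k _ k' _ h
    have h1 : w k = w k' := Sym2.congr_right.1 (congrArg Subtype.val h)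
    have h2 := congrArg (fun v : Fin n => (v : ℕ) / r) h1
    simp only [w, hdiv] at h2
    exact Fin.ext (by omega)

lemma isCut_flipCut_iff {n r m t : ℕ} (hr : 2 ≤ r) (s : ℕ → Prop) (ht : t < m)
    {e : EdgeType n} (he : e ∈ starEdges n r m t) : IsCut (flipCut n hr m s) e ↔ ¬ s t := by
  obtain ⟨u, w, huw, hu, hw, hw', -⟩ := (Finset.mem_filter.1 he).2
  obtain ⟨e, hd⟩ := e
  simp only at huw
  subst huw
  rw [isCut_mk]
  have h1 : (u : ℕ) / r = t := by rw [hu, Nat.mul_div_cancel_left _ (by omega)]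
  have h2 : (u : ℕ) % r = 0 := by rw [hu, Nat.mul_mod_right]
  have h3 : ¬ (w : ℕ) / r < m := by omega
  simp only [flipCut, h1, h2, hw, h3, ht, true_and, false_and, if_false]
  split_ifs with h
  · simp [h]
  · simp [h]

/-- The cut of `G` obtained by flipping every pair whose star has fewer edges than expected. -/
def starCut {n r : ℕ} (hr : 2 ≤ r) (m : ℕ) (p : ℝ) (G : EdgeGraph n) : Fin n → Fin r :=
  flipCut n hr m fun t => t < m ∧ dev p (starEdges n r m t) G < 0

lemma starCut_congr {n r : ℕ} (hr : 2 ≤ r) (m : ℕ) (p : ℝ) {e : EdgeType n}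
    (he : ∀ t < m, e ∉ starEdges n r m t) (G : EdgeGraph n) :
    starCut hr m p (insert e G) = starCut hr m p (G.erase e) := by
  unfold starCut
  congr 1
  ext t
  exact and_congr_right fun ht => by rw [dev_congr p (he t ht)]

lemma cutSize_eq_add_sum_edgeDev {n r : ℕ} (p : ℝ) (φ : Fin n → Fin r) (G : EdgeGraph n) :
    (cutSize φ G : ℝ) = p * (Finset.univ.filter (IsCut φ)).card +
      ∑ e, edgeDev p e G * if IsCut φ e then 1 else 0 := by
  have e1 : (cutSize φ G : ℝ) = ∑ e, if e ∈ G then (if IsCut φ e then (1 : ℝ) else 0) else 0 := by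
    rw [Finset.sum_ite_mem, Finset.univ_inter, Finset.sum_boole, cutSize_def]
  have e2 : ((Finset.univ.filter (IsCut φ)).card : ℝ) = ∑ e, if IsCut φ e then (1 : ℝ) else 0 := by
    rw [Finset.sum_boole]
  rw [e1, e2, Finset.mul_sum, ← Finset.sum_add_distrib]
  refine Finset.sum_congr rfl fun e _ => ?_
  unfold edgeDev
  split_ifs <;> ring

lemma le_exGnp_maxCut {n r m : ℕ} {p : ℝ} (hr : 2 ≤ r) (hm : 2 * m * r ≤ n) (h0 : 0 ≤ p)
    (h1 : p ≤ 1) (hV : 1 ≤ m * (p * (1 - p))) :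
    p * ((1 - 1 / (r : ℝ)) * n ^ 2 / 2 - n / 2) + m * (√(m * (p * (1 - p))) / 4) ≤
      exGnp n p (fun G => (maxCut n r G : ℝ)) := by
  have hq : 0 ≤ p * (1 - p) := mul_nonneg h0 (sub_nonneg.2 h1)
  let S := fun t => starEdges n r m t
  let U := (Finset.range m).biUnion S
  have hlow : ∀ G : EdgeGraph n, p * ((1 - 1 / (r : ℝ)) * n ^ 2 / 2 - n / 2) +
      (∑ t ∈ Finset.range m, (1 / 2 * |dev p (S t) G| + 1 / 2 * dev p (S t) G) +
        ∑ e ∈ Uᶜ, edgeDev p e G * if IsCut (starCut hr m p G) e then 1 else 0) ≤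
      (maxCut n r G : ℝ) := by
    intro G
    refine le_trans ?_ (Nat.cast_le.2 (cutSize_le_maxCut (starCut hr m p G) G))
    rw [cutSize_eq_add_sum_edgeDev p]
    refine add_le_add (mul_le_mul_of_nonneg_left
      (le_card_isCut _ (card_fiber_flipCut_le n hr m _)) h0) (le_of_eq ?_)
    rw [← Finset.sum_add_sum_compl U, Finset.sum_biUnion
      fun t _ t' _ h => disjoint_starEdges n m hr h]
    congr 1
    refine Finset.sum_congr rfl fun t ht => ?_
    have ht := Finset.mem_range.1 ht
    have hc : ∀ e ∈ S t, (edgeDev p e G * if IsCut (starCut hr m p G) e then (1 : ℝ) else 0) =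
        edgeDev p e G * if dev p (S t) G < 0 then 0 else 1 := by
      intro e he
      congr 1
      rw [starCut]
      simp only [isCut_flipCut_iff hr _ ht he, ht, true_and, ite_not]
      rfl
    rw [Finset.sum_congr rfl hc, ← Finset.sum_mul, ← dev]
    split_ifs with h
    · rw [abs_of_neg h]
      ring
    · rw [abs_of_nonneg (not_lt.1 h)]
      ring
  refine le_trans ?_ (exGnp_mono h0 h1 hlow)
  rw [exGnp_add, exGnp_const, exGnp_add, exGnp_sum, exGnp_sum]
  have hz : ∑ e ∈ Uᶜ, exGnp n p (fun G => edgeDev p e G *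
      if IsCut (starCut hr m p G) e then 1 else 0) = 0 := by
    refine Finset.sum_eq_zero fun e he => exGnp_edgeDev_mul p e _ fun G => ?_
    rw [starCut_congr hr m p]
    intro t ht h
    exact Finset.mem_compl.1 he (Finset.mem_biUnion.2 ⟨t, Finset.mem_range.2 ht, h⟩)
  rw [hz, add_zero]
  gcongr
  have hcard := Finset.card_nsmul_le_sum (Finset.range m)
    (fun t => exGnp n p fun G => 1 / 2 * |dev p (S t) G| + 1 / 2 * dev p (S t) G)
    (√(m * (p * (1 - p))) / 4) ?_
  · simpa using hcard
  intro t ht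
  rw [exGnp_add, exGnp_const_mul, exGnp_const_mul, exGnp_dev]
  have hle : (m : ℝ) * (p * (1 - p)) ≤ (S t).card * (p * (1 - p)) :=
    mul_le_mul_of_nonneg_right
      (Nat.cast_le.2 (le_card_starEdges hr hm (Finset.mem_range.1 ht))) hq
  have h2 := le_exGnp_abs_dev h0 h1 (S t) (hV.trans hle)
  have h3 := Real.sqrt_le_sqrt hle
  linarith

/-- If `r ≥ 2`, `δ > 0`, `np → ∞` and `p ≤ 1 - δ`, then `E[x_r(G_{n,p})] = Ω(√(n/p))`. -/
theorem expected_vertices_outside_core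
    (r : ℕ) (hr : 2 ≤ r) (δ : ℝ) (hδ : 0 < δ)
    (p : ℕ → ℝ) (hp0 : ∀ n, 0 ≤ p n) (hp1 : ∀ n, p n ≤ 1 - δ)
    (hnp : Tendsto (fun n : ℕ => (n : ℝ) * p n) atTop atTop) :
    ∃ c : ℝ, 0 < c ∧ ∃ n₀ : ℕ, ∀ n : ℕ, n₀ ≤ n →
      c * Real.sqrt ((n : ℝ) / p n) ≤ exGnp n (p n) (fun G => (xr r G : ℝ)) := by
  have hr0 : (0 : ℝ) < r := by exact_mod_cast (by omega : 0 < r)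
  have : NeZero r := ⟨by omega⟩
  set α : ℝ := √(δ / (4 * r)) / (16 * r) with hα
  have hα0 : 0 < α := by positivity
  set β : ℝ := 1 / 2 + (r + 1) / 4 with hβ
  refine ⟨α / (2 * (2 * r + 3)), by positivity, ?_⟩
  obtain ⟨n₀, hn₀⟩ := ((eventually_ge_atTop (2 * r)).and
    (((hnp.eventually_ge_atTop (4 * r / δ)).and
      (hnp.eventually_ge_atTop ((2 * β / α) ^ 2))).and
      (hnp.eventually_gt_atTop 0))).exists_forall_of_atTop
  refine ⟨n₀, fun n hn => ?_⟩
  obtain ⟨hn2, ⟨hy1, hy2⟩, hy0⟩ := hn₀ n hn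
  have h0 := hp0 n
  have hδ1 := hp1 n
  set q := p n
  have h1 : q ≤ 1 := by linarith
  have hn0 : (0 : ℝ) < n := by
    rcases Nat.eq_zero_or_pos n with h | h
    · omega
    · exact_mod_cast h
  have hq0 : 0 < q := pos_of_mul_pos_right hy0 hn0.le
  set m := n / (2 * r)
  have hmn : 2 * m * r ≤ n := by
    rw [mul_right_comm, mul_comm]
    exact Nat.div_mul_le_self n (2 * r)
  have hm : (n : ℝ) / (4 * r) ≤ m := by
    have h2 : n < (m + 1) * (2 * r) := by
      rw [mul_comm]
      exact Nat.lt_mul_div_succ n (by omega)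
    have h3 : 1 ≤ m := Nat.div_pos hn2 (by omega)
    have h4 : n ≤ m * (4 * r) := by nlinarith
    rw [div_le_iff₀ (by positivity)]
    exact_mod_cast h4
  have hmq : n * q * (δ / (4 * r)) ≤ m * (q * (1 - q)) := by
    calc n * q * (δ / (4 * r)) = n / (4 * r) * (q * δ) := by ring
      _ ≤ m * (q * (1 - q)) := by
        gcongr
        linarith
  have hV : 1 ≤ m * (q * (1 - q)) := by
    refine le_trans ?_ hmq
    calc (1 : ℝ) = 4 * r / δ * (δ / (4 * r)) := by field_simp
      _ ≤ _ := by gcongr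
  have hlow := le_exGnp_maxCut hr hmn h0 h1 hV
  have hup := exGnp_maxCut_le (r := r) h0 h1 hy0
  set x := exGnp n q (fun G => (xr r G : ℝ))
  set y := (n : ℝ) * q with hy
  have hs : α * (n * √y) ≤ m * (√(m * (q * (1 - q))) / 4) := by
    have h2 := Real.sqrt_le_sqrt hmq
    rw [Real.sqrt_mul hy0.le] at h2
    calc α * (n * √y) = n / (4 * r) * (√y * √(δ / (4 * r)) / 4) := by
          rw [hα]
          field_simp
          norm_num
      _ ≤ _ := by gcongr
  have hβy : 2 * β ≤ α * √y := by
    have h2 := Real.le_sqrt_of_sq_le hy2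
    rw [div_le_iff₀ hα0] at h2
    linarith
  have hβn : n * (2 * β) ≤ n * (α * √y) := by gcongr
  have hqn : q * n ≤ n := mul_le_of_le_one_left hn0.le h1
  have hfin : α / 2 * (n * √y) ≤ (2 * r + 3) * y * x := by
    have e : (n : ℝ) * (2 * β) = n + (r + 1) * n / 2 := by
      rw [hβ]
      ring
    rw [e] at hβn
    linarith
  have hsqrt : √(n / q) = n / √y := by
    have : (n : ℝ) / q = n ^ 2 / y := by
      rw [hy]
      field_simp
    rw [this, Real.sqrt_div (by positivity), Real.sqrt_sq hn0.le]
  have hsy : 0 < √y := Real.sqrt_pos.2 hy0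
  rw [hsqrt]
  have h5 : α / (2 * (2 * r + 3)) * (n / √y) = α / 2 * (n * √y) / ((2 * r + 3) * y) := by
    have h6 : n / √y = n * √y / y := by
      rw [div_eq_div_iff hsy.ne' hy0.ne', mul_assoc, Real.mul_self_sqrt hy0.le]
    rw [h6]
    field_simp
  rw [h5, div_le_iff₀ (by positivity)]
  linarith

end
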